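/- Let f : R → σ⁻¹R be a universally σ-inverting ring homomorphism. Let M be a right R-module such that for every s : P → Q in σ the induced map 1_M ⊗ s : M ⊗_R P → M ⊗_R Q is bijective. Then the map M → M ⊗_R σ⁻¹R, m ↦ m ⊗ 1, is bijective, and Tor_1^R(M, σ⁻¹R) = 0 (here σ⁻¹R is regarded as a left R-module via f). -/

import Mathlib

open MulOpposite

universe u

section BTensorCore

variable (R : Type u) [Ring R]
variable (M : Type u) [AddCommGroup M] [Module Rᵐᵒᵖ M]
variable (N : Type u) [AddCommGroup N] [Module R N]

/-- The subgroup of relations defining the balanced tensor product `M ⊗_R N`. -/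
noncomputable def btRel : AddSubgroup (TensorProduct ℤ M N) :=
  AddSubgroup.closure
    { x | ∃ (m : M) (r : R) (n : N), x = (op r • m) ⊗ₜ[ℤ] n - m ⊗ₜ[ℤ] (r • n) }

/-- The balanced tensor product `M ⊗_R N` of a right `R`-module `M` and a left `R`-module `N`:
the quotient of `M ⊗_ℤ N` by the relations `(m · r) ⊗ n = m ⊗ (r · n)`. -/
abbrev BTensor : Type u := TensorProduct ℤ M N ⧸ btRel R M N

variable {R M N}

/-- The image of `m ⊗ n` in `M ⊗_R N`. -/
noncomputable def BTensor.tmul (m : M) (n : N) : BTensor R M N :=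
  QuotientAddGroup.mk (m ⊗ₜ[ℤ] n)

variable {A : Type u} [AddCommGroup A]

/-- Lift a balanced biadditive map `M → N → A` to `M ⊗_R N → A`. -/
noncomputable def BTensor.lift (b : M →+ N →+ A)
    (hb : ∀ (r : R) (m : M) (n : N), b (op r • m) n = b m (r • n)) :
    BTensor R M N →+ A :=
  QuotientAddGroup.lift (btRel R M N)
    (TensorProduct.liftAddHom b (fun z m n => by
      simp [map_zsmul]))
    ((AddSubgroup.closure_le _).mpr (by
      rintro y ⟨m, r, n, rfl⟩
      simp [AddMonoidHom.mem_ker, hb r m n]))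

/-- Lift a balanced biadditive map given as a bare function. -/
noncomputable def BTensor.lift' (b : M → N → A)
    (h1 : ∀ m m' n, b (m + m') n = b m n + b m' n)
    (h2 : ∀ m n n', b m (n + n') = b m n + b m n')
    (hb : ∀ (r : R) m n, b (op r • m) n = b m (r • n)) :
    BTensor R M N →+ A :=
  BTensor.lift (AddMonoidHom.mk' (fun m => AddMonoidHom.mk' (b m) (h2 m))
    (fun m m' => AddMonoidHom.ext fun n => h1 m m' n)) hb

section MapRight

variable {N' : Type u} [AddCommGroup N'] [Module R N']

/-- The map `1 ⊗ g : M ⊗_R N → M ⊗_R N'` induced by a map `g` of left `R`-modules. -/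
noncomputable def BTensor.mapRight (g : N →ₗ[R] N') : BTensor R M N →+ BTensor R M N' :=
  QuotientAddGroup.map _ _
    (TensorProduct.map (LinearMap.id (R := ℤ) (M := M)) g.toAddMonoidHom.toIntLinearMap).toAddMonoidHom
    ((AddSubgroup.closure_le _).mpr (by
      rintro y ⟨m, r, n, rfl⟩
      refine AddSubgroup.mem_comap.mpr (AddSubgroup.subset_closure ?_)
      exact ⟨m, r, g n, by simp⟩))

end MapRight

section MapLeft

variable {M' : Type u} [AddCommGroup M'] [Module Rᵐᵒᵖ M']

/-- The map `g ⊗ 1 : M ⊗_R N → M' ⊗_R N` induced by a map `g` of right `R`-modules. -/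
noncomputable def BTensor.mapLeft (g : M →ₗ[Rᵐᵒᵖ] M') : BTensor R M N →+ BTensor R M' N :=
  QuotientAddGroup.map _ _
    (TensorProduct.map g.toAddMonoidHom.toIntLinearMap (LinearMap.id (R := ℤ) (M := N))).toAddMonoidHom
    ((AddSubgroup.closure_le _).mpr (by
      rintro y ⟨m, r, n, rfl⟩
      refine AddSubgroup.mem_comap.mpr (AddSubgroup.subset_closure ?_)
      exact ⟨g m, r, n, by simp⟩))

end MapLeft

end BTensorCore
section Localization

variable {R : Type u} [Ring R] {ι : Type u}
  {P Q : ι → Type u}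
  [∀ i, AddCommGroup (P i)] [∀ i, Module R (P i)]
  [∀ i, AddCommGroup (Q i)] [∀ i, Module R (Q i)]

/-- A ring homomorphism `f : R → S`, together with a right `R`-module structure on `S`, is
`σ`-inverting if the right `R`-action on `S` is the one induced by `f` (i.e. `x • r = x * f r`)
and, for every `s i : P i → Q i` in `σ`, the induced map
`1 ⊗ s i : S ⊗_R P i → S ⊗_R Q i` is bijective. -/
def IsInvertingHom (s : ∀ i, P i →ₗ[R] Q i) (S : Type u) [Ring S] [Module Rᵐᵒᵖ S]
    (f : R →+* S) : Prop :=
  (∀ (r : R) (x : S), op r • x = x * f r) ∧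
    ∀ i, Function.Bijective (BTensor.mapRight (M := S) (s i))

/-- `f : R → S` is universally `σ`-inverting if it is `σ`-inverting and every `σ`-inverting
ring homomorphism `g : R → T` factors through `f` by a unique ring homomorphism `S → T`. -/
def IsUniversalInverting (s : ∀ i, P i →ₗ[R] Q i) (S : Type u) [Ring S] [Module Rᵐᵒᵖ S]
    (f : R →+* S) : Prop :=
  IsInvertingHom s S f ∧
    ∀ (T : Type u) (_ : Ring T) (_ : Module Rᵐᵒᵖ T) (g : R →+* T),
      IsInvertingHom s T g → ∃! h : S →+* T, g = h.comp f

/-- `Tor_1^R(M, N) = 0`: for every short exact sequence `0 → K → F → M → 0` of right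
`R`-modules with `F` projective, the induced map `K ⊗_R N → F ⊗_R N` is injective. -/
def Tor1Vanishes (R : Type u) [Ring R] (M : Type u) [AddCommGroup M] [Module Rᵐᵒᵖ M]
    (N : Type u) [AddCommGroup N] [Module R N] : Prop :=
  ∀ (K F : Type u) (_ : AddCommGroup K) (_ : Module Rᵐᵒᵖ K)
    (_ : AddCommGroup F) (_ : Module Rᵐᵒᵖ F)
    (i : K →ₗ[Rᵐᵒᵖ] F) (p : F →ₗ[Rᵐᵒᵖ] M),
    Module.Projective Rᵐᵒᵖ F → Function.Injective i → Function.Surjective p →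
    (∀ x, p x = 0 ↔ x ∈ Set.range i) →
    Function.Injective (BTensor.mapLeft (N := N) i)

end Localization

section BTensorLemmas

variable {R : Type u} [Ring R]
  {M : Type u} [AddCommGroup M] [Module Rᵐᵒᵖ M]
  {M' : Type u} [AddCommGroup M'] [Module Rᵐᵒᵖ M']
  {L : Type u} [AddCommGroup L] [Module R L]
  {L' : Type u} [AddCommGroup L'] [Module R L']

namespace BTensor

lemma add_tmul (m m' : M) (l : L) :
    tmul (R := R) (m + m') l = tmul m l + tmul m' l := by
  simp only [tmul, TensorProduct.add_tmul, QuotientAddGroup.mk_add]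

lemma tmul_add (m : M) (l l' : L) :
    tmul (R := R) m (l + l') = tmul m l + tmul m l' := by
  simp only [tmul, TensorProduct.tmul_add, QuotientAddGroup.mk_add]

lemma smul_tmul (r : R) (m : M) (l : L) :
    tmul (R := R) (op r • m) l = tmul m (r • l) := by
  refine QuotientAddGroup.eq_iff_sub_mem.mpr (AddSubgroup.subset_closure ⟨m, r, l, rfl⟩)

/-- `m ↦ m ⊗ l` as an additive map. -/
noncomputable def tmulLeft (l : L) : M →+ BTensor R M L :=
  AddMonoidHom.mk' (fun m => tmul m l) fun m₁ m₂ => add_tmul m₁ m₂ l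

/-- `l ↦ m ⊗ l` as an additive map. -/
noncomputable def tmulRight (m : M) : L →+ BTensor R M L :=
  AddMonoidHom.mk' (fun l => tmul m l) fun l₁ l₂ => tmul_add m l₁ l₂

@[simp] lemma tmulLeft_apply (m : M) (l : L) : tmulLeft (R := R) l m = tmul m l := rfl

@[simp] lemma tmulRight_apply (m : M) (l : L) : tmulRight (R := R) m l = tmul m l := rfl

@[elab_as_elim]
lemma induction {p : BTensor R M L → Prop} (zero : p 0) (tmul : ∀ m l, p (tmul m l))
    (add : ∀ x y, p x → p y → p (x + y)) (z : BTensor R M L) : p z := by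
  obtain ⟨x, rfl⟩ := QuotientAddGroup.mk_surjective z
  refine TensorProduct.induction_on x zero tmul fun x y hx hy => ?_
  exact add _ _ hx hy

lemma hom_ext {A : Type*} [AddCommGroup A] {φ ψ : BTensor R M L →+ A}
    (h : ∀ m l, φ (tmul m l) = ψ (tmul m l)) : φ = ψ := by
  refine AddMonoidHom.ext fun z => ?_
  induction z using induction with
  | zero => simp
  | tmul m l => exact h m l
  | add x y hx hy => simp [hx, hy]

@[simp] lemma mapRight_tmul (g : L →ₗ[R] L') (m : M) (l : L) :
    mapRight g (tmul m l) = tmul m (g l) := rfl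

@[simp] lemma mapLeft_tmul (g : M →ₗ[Rᵐᵒᵖ] M') (m : M) (l : L) :
    mapLeft g (tmul m l) = tmul (g m) l := rfl

@[simp] lemma lift'_tmul {A : Type u} [AddCommGroup A] (b : M → L → A)
    (h1 : ∀ m m' n, b (m + m') n = b m n + b m' n)
    (h2 : ∀ m n n', b m (n + n') = b m n + b m n')
    (hb : ∀ (r : R) m n, b (op r • m) n = b m (r • n)) (m : M) (l : L) :
    lift' b h1 h2 hb (tmul m l) = b m l := rfl

lemma mapLeft_mapRight (g : M →ₗ[Rᵐᵒᵖ] M') (k : L →ₗ[R] L') (z : BTensor R M L) :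
    mapLeft g (mapRight k z) = mapRight k (mapLeft g z) :=
  DFunLike.congr_fun (hom_ext (φ := (mapLeft g).comp (mapRight k))
    (ψ := (mapRight k).comp (mapLeft g)) fun _ _ => rfl) z

/-- The contraction `M ⊗_R L → M`, `m ⊗ l ↦ m · ℓ(l)`, along a linear form `ℓ` on `L`. -/
noncomputable def contract (ℓ : L →ₗ[R] R) : BTensor R M L →+ M :=
  lift' (fun m l => op (ℓ l) • m) (fun _ _ _ => smul_add _ _ _)
    (fun _ _ _ => by simp [add_smul]) (fun _ _ _ => by simp [mul_smul])

@[simp] lemma contract_tmul (ℓ : L →ₗ[R] R) (m : M) (l : L) :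
    contract ℓ (tmul m l) = op (ℓ l) • m := rfl

lemma contract_mapLeft (ℓ : L →ₗ[R] R) (g : M →ₗ[Rᵐᵒᵖ] M') (z : BTensor R M L) :
    contract ℓ (mapLeft g z) = g (contract ℓ z) :=
  DFunLike.congr_fun (hom_ext (φ := (contract ℓ).comp (mapLeft g))
    (ψ := g.toAddMonoidHom.comp (contract ℓ)) fun m l => by simp) z

lemma sum_contract_tmul {n : ℕ} (e : Fin n → L) (ℓ : Fin n → L →ₗ[R] R)
    (h : ∀ l, ∑ j, ℓ j l • e j = l) (z : BTensor R M L) :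
    ∑ j, tmul (contract (ℓ j) z) (e j) = z := by
  have key : ∑ j, (tmulLeft (e j)).comp (contract (ℓ j)) =
      AddMonoidHom.id (BTensor R M L) := hom_ext fun m l => by
    simp only [AddMonoidHom.finsetSum_apply, AddMonoidHom.comp_apply, contract_tmul,
      tmulLeft_apply, smul_tmul, AddMonoidHom.id_apply]
    conv_rhs => rw [← h l]
    simp only [← tmulRight_apply, map_sum]
  simpa using DFunLike.congr_fun key z

variable (R L) in
lemma exists_dual_basis [Module.Finite R L] [Module.Projective R L] :
    ∃ (n : ℕ) (e : Fin n → L) (ℓ : Fin n → L →ₗ[R] R), ∀ l, ∑ j, ℓ j l • e j = l := by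
  obtain ⟨n, p, i, -, -, h⟩ := Module.Finite.exists_comp_eq_id_of_projective R L
  refine ⟨n, fun j => p (Pi.single j 1), fun j => LinearMap.proj j ∘ₗ i, fun l => ?_⟩
  conv_rhs => rw [← LinearMap.id_apply (R := R) l, ← h, LinearMap.comp_apply,
    pi_eq_sum_univ' (i l)]
  simp [← map_smul, ← Pi.single_smul]

lemma mapLeft_injective [Module.Finite R L] [Module.Projective R L] {g : M →ₗ[Rᵐᵒᵖ] M'}
    (hg : Function.Injective g) : Function.Injective (mapLeft (N := L) g) := by
  obtain ⟨n, e, ℓ, h⟩ := exists_dual_basis R L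
  intro z w hzw
  rw [← sum_contract_tmul e ℓ h z, ← sum_contract_tmul e ℓ h w]
  refine Finset.sum_congr rfl fun j _ => congrArg (tmul · (e j)) (hg ?_)
  rw [← contract_mapLeft, hzw, contract_mapLeft]

lemma mapLeft_surjective {g : M →ₗ[Rᵐᵒᵖ] M'}
    (hg : Function.Surjective g) : Function.Surjective (mapLeft (N := L) g) := by
  intro z
  induction z using induction with
  | zero => exact ⟨0, map_zero _⟩
  | tmul m l =>
    obtain ⟨m, rfl⟩ := hg m
    exact ⟨tmul m l, rfl⟩
  | add x y hx hy =>
    obtain ⟨x, rfl⟩ := hx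
    obtain ⟨y, rfl⟩ := hy
    exact ⟨x + y, map_add _ _ _⟩

lemma exists_mapLeft_eq [Module.Finite R L] [Module.Projective R L]
    {M'' : Type u} [AddCommGroup M''] [Module Rᵐᵒᵖ M'']
    {g : M →ₗ[Rᵐᵒᵖ] M'} {k : M' →ₗ[Rᵐᵒᵖ] M''} (hgk : ∀ x, k x = 0 → ∃ y, g y = x)
    {z : BTensor R M' L} (hz : mapLeft k z = 0) : ∃ w, mapLeft g w = z := by
  obtain ⟨n, e, ℓ, h⟩ := exists_dual_basis R L
  have (j : Fin n) : ∃ y, g y = contract (ℓ j) z :=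
    hgk _ (by rw [← contract_mapLeft, hz, map_zero])
  choose y hy using this
  refine ⟨∑ j, tmul (y j) (e j), ?_⟩
  simp only [map_sum, mapLeft_tmul, hy, sum_contract_tmul e ℓ h z]

/-- If `1 ⊗ s` is bijective for the outer terms of a short exact sequence of right modules, then
it is bijective for the middle term. -/
lemma bijective_mapRight_of_exact
    [Module.Finite R L] [Module.Projective R L] [Module.Finite R L'] [Module.Projective R L']
    {M'' : Type u} [AddCommGroup M''] [Module Rᵐᵒᵖ M'']
    {g : M →ₗ[Rᵐᵒᵖ] M'} {k : M' →ₗ[Rᵐᵒᵖ] M''} (hg : Function.Injective g)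
    (hk : Function.Surjective k) (hkg : ∀ x, k (g x) = 0) (hgk : ∀ x, k x = 0 → ∃ y, g y = x)
    (s : L →ₗ[R] L') (hs : Function.Bijective (mapRight (M := M) s))
    (hs'' : Function.Bijective (mapRight (M := M'') s)) :
    Function.Bijective (mapRight (M := M') s) := by
  have hz (z : BTensor R M L) : mapLeft k (mapLeft g z) = 0 := by
    refine DFunLike.congr_fun (hom_ext (φ := (mapLeft k).comp (mapLeft g)) (ψ := 0)
      fun m l => ?_) z
    simp only [AddMonoidHom.comp_apply, mapLeft_tmul, hkg, AddMonoidHom.zero_apply]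
    exact map_zero (tmulLeft l)
  constructor
  · refine (injective_iff_map_eq_zero _).mpr fun z hsz => ?_
    obtain ⟨w, rfl⟩ := exists_mapLeft_eq (z := z) hgk <| hs''.1 <| by
      rw [← mapLeft_mapRight, hsz, map_zero, map_zero]
    rw [← mapLeft_mapRight] at hsz
    have hw : w = 0 := hs.1 <| mapLeft_injective hg <| by rw [hsz, map_zero, map_zero]
    rw [hw, map_zero]
  · intro w
    obtain ⟨z'', hz''⟩ := hs''.2 (mapLeft k w)
    obtain ⟨z, rfl⟩ := mapLeft_surjective hk z''
    obtain ⟨v, hv⟩ := exists_mapLeft_eq (z := w - mapRight s z) hgk <| by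
      rw [map_sub, mapLeft_mapRight, hz'', sub_self]
    obtain ⟨u, rfl⟩ := hs.2 v
    refine ⟨mapLeft g u + z, ?_⟩
    rw [map_add, ← mapLeft_mapRight, hv, sub_add_cancel]

/-- Right `R`-modules whose action extends along a ring homomorphism `f : R → S` invert every map
inverted by `S`. -/
lemma bijective_mapRight_of_module {S : Type u} [Ring S] [Module Rᵐᵒᵖ S] {f : R →+* S}
    (hf : ∀ (r : R) (x : S), op r • x = x * f r) [Module Sᵐᵒᵖ M]
    (hM : ∀ (r : R) (m : M), op (f r) • m = op r • m) (s : L →ₗ[R] L')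
    (hs : Function.Bijective (mapRight (M := S) s)) :
    Function.Bijective (mapRight (M := M) s) := by
  let t := (AddEquiv.ofBijective _ hs).symm
  have st (z) : mapRight s (t z) = z := (AddEquiv.ofBijective _ hs).apply_symm_apply z
  have ts (z) : t (mapRight s z) = z := (AddEquiv.ofBijective _ hs).symm_apply_apply z
  let lmul (a : S) : S →ₗ[Rᵐᵒᵖ] S :=
    { toFun x := a * x
      map_add' := mul_add a
      map_smul' r x := by
        obtain ⟨r, rfl⟩ := op_surjective r
        simp [hf, mul_assoc] }
  let act (m : M) : S →ₗ[Rᵐᵒᵖ] M :=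
    { toFun a := op a • m
      map_add' a b := by simp [add_smul]
      map_smul' r x := by
        obtain ⟨r, rfl⟩ := op_surjective r
        simp [hf, mul_smul, hM] }
  have t_lmul (a : S) (z : BTensor R S L') : t (mapLeft (lmul a) z) = mapLeft (lmul a) (t z) :=
    hs.1 <| by rw [st, ← mapLeft_mapRight, st]
  have act_lmul (m : M) (r : R) (z : BTensor R S L) :
      mapLeft (act m) (mapLeft (lmul (f r)) z) = mapLeft (act (op r • m)) z := by
    refine DFunLike.congr_fun (hom_ext (φ := (mapLeft (act m)).comp (mapLeft (lmul (f r))))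
      (ψ := mapLeft (act (op r • m))) fun a l => ?_) z
    simp [act, lmul, mul_smul, hM]
  have act_add (m m' : M) (z : BTensor R S L) :
      mapLeft (act (m + m')) z = mapLeft (act m) z + mapLeft (act m') z := by
    refine DFunLike.congr_fun (hom_ext (φ := mapLeft (act (m + m')))
      (ψ := mapLeft (act m) + mapLeft (act m')) fun a l => ?_) z
    simp [act, add_tmul]
  let inv : BTensor R M L' →+ BTensor R M L :=
    lift' (fun m l => mapLeft (act m) (t (tmul 1 l))) (fun m m' l => act_add m m' _)
      (fun m l l' => by simp [tmul_add]) (fun r m l => by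
        rw [← smul_tmul, hf, one_mul, ← act_lmul, ← t_lmul]
        simp [lmul])
  have act_one (m : M) : act m 1 = m := by simp [act]
  refine Function.bijective_iff_has_inverse.mpr ⟨inv, fun z => ?_, fun z => ?_⟩
  · refine DFunLike.congr_fun (hom_ext (φ := inv.comp (mapRight s)) (ψ := AddMonoidHom.id _)
      fun m l => ?_) z
    simp only [AddMonoidHom.comp_apply, mapRight_tmul, inv, lift'_tmul, AddMonoidHom.id_apply]
    rw [← mapRight_tmul, ts, mapLeft_tmul, act_one]
  · refine DFunLike.congr_fun (hom_ext (φ := (mapRight s).comp inv) (ψ := AddMonoidHom.id _)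
      fun m l => ?_) z
    simp only [AddMonoidHom.comp_apply, inv, lift'_tmul, AddMonoidHom.id_apply]
    rw [← mapLeft_mapRight, st, mapLeft_tmul, act_one]

/-- If `M` inverts a map between finitely generated projective modules, then so does the ring of
additive endomorphisms of `M`, acting on `M` from the right. -/
lemma bijective_mapRight_end
    [Module.Finite R L] [Module.Projective R L] [Module.Finite R L'] [Module.Projective R L']
    (s : L →ₗ[R] L') (hs : Function.Bijective (mapRight (M := M) s)) :
    Function.Bijective (mapRight (M := (AddMonoid.End M)ᵐᵒᵖ) s) := by
  let ev (m : M) : (AddMonoid.End M)ᵐᵒᵖ →ₗ[Rᵐᵒᵖ] M :=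
    { toFun x := x.unop m
      map_add' x y := rfl
      map_smul' r x := rfl }
  have ev_inj {N : Type u} [AddCommGroup N] [Module R N] [Module.Finite R N]
      [Module.Projective R N] {z w : BTensor R (AddMonoid.End M)ᵐᵒᵖ N}
      (h : ∀ m, mapLeft (ev m) z = mapLeft (ev m) w) : z = w := by
    obtain ⟨n, e, ℓ, he⟩ := exists_dual_basis R N
    rw [← sum_contract_tmul e ℓ he z, ← sum_contract_tmul e ℓ he w]
    refine Finset.sum_congr rfl fun j _ => congrArg (tmul · (e j)) ?_
    refine unop_injective (AddMonoidHom.ext fun m => ?_)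
    change ev m _ = ev m _
    rw [← contract_mapLeft, h, contract_mapLeft]
  constructor
  · intro z w hzw
    refine ev_inj fun m => hs.1 ?_
    rw [← mapLeft_mapRight, hzw, mapLeft_mapRight]
  · intro w
    let t := (AddEquiv.ofBijective _ hs).symm
    have st (z) : mapRight s (t z) = z := (AddEquiv.ofBijective _ hs).apply_symm_apply z
    obtain ⟨n, e, ℓ, he⟩ := exists_dual_basis R L
    have ev_add (m m' : M) (z : BTensor R (AddMonoid.End M)ᵐᵒᵖ L') :
        mapLeft (ev (m + m')) z = mapLeft (ev m) z + mapLeft (ev m') z := by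
      refine DFunLike.congr_fun (hom_ext (φ := mapLeft (ev (m + m')))
        (ψ := mapLeft (ev m) + mapLeft (ev m')) fun a l => ?_) z
      rw [AddMonoidHom.add_apply, mapLeft_tmul, mapLeft_tmul, mapLeft_tmul, ← add_tmul]
      exact congrArg (tmul · l) (map_add a.unop m m')
    let x (j : Fin n) : AddMonoid.End M :=
      AddMonoidHom.mk' (fun m => contract (ℓ j) (t (mapLeft (ev m) w)))
        fun m m' => by simp [ev_add]
    refine ⟨∑ j, tmul (op (x j)) (e j), ev_inj fun m => ?_⟩
    have hx : mapLeft (ev m) (∑ j, tmul (op (x j)) (e j)) = t (mapLeft (ev m) w) := by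
      rw [map_sum, ← sum_contract_tmul e ℓ he (t (mapLeft (ev m) w))]
      rfl
    rw [mapLeft_mapRight, hx, st]

/-- The right `S`-module structure on `M ⊗_R S`. -/
@[reducible] noncomputable def rightModule {S : Type u} [Ring S] [Module R S] {f : R →+* S}
    (hleft : ∀ (r : R) (x : S), r • x = f r * x) : Module Sᵐᵒᵖ (BTensor R M S) :=
  let rmul (a : Sᵐᵒᵖ) : S →ₗ[R] S :=
    { toFun x := x * a.unop
      map_add' x y := add_mul x y _
      map_smul' r x := by simp [hleft, mul_assoc] }
  have ext {φ ψ : BTensor R M S →+ BTensor R M S}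
      (h : ∀ m x, φ (tmul m x) = ψ (tmul m x)) (z) : φ z = ψ z :=
    DFunLike.congr_fun (hom_ext h) z
  { smul a z := mapRight (rmul a) z
    one_smul := ext (φ := mapRight (rmul 1)) (ψ := AddMonoidHom.id _) fun m x => by simp [rmul]
    mul_smul a b := ext (φ := mapRight (rmul (a * b)))
      (ψ := (mapRight (rmul a)).comp (mapRight (rmul b))) fun m x => by simp [rmul, mul_assoc]
    smul_zero a := map_zero (mapRight (rmul a))
    smul_add a := map_add (mapRight (rmul a))
    add_smul a b := ext (φ := mapRight (rmul (a + b)))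
      (ψ := mapRight (rmul a) + mapRight (rmul b)) fun m x => by simp [rmul, mul_add, tmul_add]
    zero_smul := ext (φ := mapRight (rmul 0)) (ψ := 0) fun m x => by
      simpa [rmul] using map_zero (tmulRight (R := R) (L := S) m) }

end BTensor

end BTensorLemmas

section UniversalLemmas

variable {R : Type u} [Ring R] {ι : Type u}
  {P Q : ι → Type u}
  [∀ i, AddCommGroup (P i)] [∀ i, Module R (P i)]
  [∀ i, AddCommGroup (Q i)] [∀ i, Module R (Q i)]
  {s : ∀ i, P i →ₗ[R] Q i} {S : Type u} [Ring S] [Module Rᵐᵒᵖ S] {f : R →+* S}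

lemma IsInvertingHom.comp (hf : IsInvertingHom s S f) {T : Type u} [Ring T] [Module Rᵐᵒᵖ T]
    (h : S →+* T) (hT : ∀ (r : R) (x : T), op r • x = x * h (f r)) :
    IsInvertingHom s T (h.comp f) := by
  let _ : Module Sᵐᵒᵖ T := Module.compHom T (RingHom.op h)
  exact ⟨hT, fun i => BTensor.bijective_mapRight_of_module hf.1
    (fun r x => (hT r x).symm) (s i) (hf.2 i)⟩

namespace IsUniversalInverting

lemma hom_ext (hf : IsUniversalInverting s S f) {T : Type u} [Ring T] {h k : S →+* T}
    (hk : h.comp f = k.comp f) : h = k := by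
  let _ : Module Rᵐᵒᵖ T := Module.compHom T (RingHom.op (h.comp f))
  exact (hf.2 T _ _ (h.comp f) (hf.1.comp h fun _ _ => rfl)).unique rfl hk

/-- A right `R`-module inverting `σ` is a right module over the universal localization. -/
lemma exists_module (hf : IsUniversalInverting s S f)
    [∀ i, Module.Finite R (P i)] [∀ i, Module.Projective R (P i)]
    [∀ i, Module.Finite R (Q i)] [∀ i, Module.Projective R (Q i)]
    {M : Type u} [AddCommGroup M] [Module Rᵐᵒᵖ M]
    (hM : ∀ i, Function.Bijective (BTensor.mapRight (M := M) (s i))) :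
    ∃ _ : Module Sᵐᵒᵖ M, ∀ (r : R) (m : M), op (f r) • m = op r • m := by
  let g : R →+* (AddMonoid.End M)ᵐᵒᵖ :=
    (RingHom.op (Module.toAddMonoidEnd Rᵐᵒᵖ M)).comp (RingEquiv.opOp R).toRingHom
  obtain ⟨h, hg, -⟩ := hf.2 (AddMonoid.End M)ᵐᵒᵖ _ _ g
    ⟨fun r x => rfl, fun i => BTensor.bijective_mapRight_end (s i) (hM i)⟩
  refine ⟨Module.compHom M
    ((RingEquiv.opOp (AddMonoid.End M)).symm.toRingHom.comp (RingHom.op h)), fun r m => ?_⟩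
  change (h (f r)).unop m = (g r).unop m
  rw [hg]
  rfl

/-- `R`-linear maps between right modules over the universal localization `S` are `S`-linear. -/
lemma map_op_smul (hf : IsUniversalInverting s S f)
    {M N : Type u} [AddCommGroup M] [Module Rᵐᵒᵖ M] [AddCommGroup N] [Module Rᵐᵒᵖ N]
    [Module Sᵐᵒᵖ M] [Module Sᵐᵒᵖ N]
    (hM : ∀ (r : R) (m : M), op (f r) • m = op r • m)
    (hN : ∀ (r : R) (n : N), op (f r) • n = op r • n)
    (φ : M →ₗ[Rᵐᵒᵖ] N) (a : S) (m : M) : φ (op a • m) = op a • φ m := by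
  let T := (AddMonoid.End (M × N))ᵐᵒᵖ
  let h : S →+* T :=
    (RingHom.op (Module.toAddMonoidEnd Sᵐᵒᵖ (M × N))).comp (RingEquiv.opOp S).toRingHom
  have h_apply (a : S) (x : M × N) : (h a).unop x = op a • x := rfl
  let shear (ψ : M →+ N) : AddMonoid.End (M × N) :=
    AddMonoidHom.mk' (fun x => (x.1, x.2 + ψ x.1)) fun x y => by
      ext <;> simp [add_add_add_comm]
  have shear_apply (ψ : M →+ N) (x : M × N) : shear ψ x = (x.1, x.2 + ψ x.1) := rfl
  let u : Tˣ :=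
    { val := op (shear (-φ.toAddMonoidHom))
      inv := op (shear φ.toAddMonoidHom)
      val_inv := unop_injective <| AddMonoidHom.ext fun x => by
        change shear φ.toAddMonoidHom (shear (-φ.toAddMonoidHom) x) = x
        simp [shear_apply]
      inv_val := unop_injective <| AddMonoidHom.ext fun x => by
        change shear (-φ.toAddMonoidHom) (shear φ.toAddMonoidHom x) = x
        simp [shear_apply] }
  let k : S →+* T :=
    { toFun a := u * h a * ↑u⁻¹
      map_one' := by simp
      map_mul' a b := by simp [mul_assoc]
      map_zero' := by simp
      map_add' a b := by simp [mul_add, add_mul] }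
  have k_apply (a : S) (x : M × N) :
      (k a).unop x = (op a • x.1, op a • (x.2 - φ x.1) + φ (op a • x.1)) := by
    change shear φ.toAddMonoidHom ((h a).unop (shear (-φ.toAddMonoidHom) x)) = _
    simp [shear_apply, h_apply, sub_eq_add_neg]
  have hk : h = k := hf.hom_ext <| RingHom.ext fun r =>
    unop_injective <| AddMonoidHom.ext fun x => by
      change (h (f r)).unop x = (k (f r)).unop x
      rw [h_apply, k_apply]
      ext <;> simp [hM, hN, smul_sub]
  have := congrArg Prod.snd (k_apply a (m, 0))
  rw [← hk, h_apply] at this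
  simpa [neg_add_eq_sub, sub_eq_zero, eq_comm (a := (0 : N))] using this

end IsUniversalInverting

end UniversalLemmas

section Localization

variable {R : Type u} [Ring R] {ι : Type u}
  {P Q : ι → Type u}
  [∀ i, AddCommGroup (P i)] [∀ i, Module R (P i)]
  [∀ i, AddCommGroup (Q i)] [∀ i, Module R (Q i)]

/-- If `f : R → σ⁻¹R` is universally `σ`-inverting and `M` is a right `R`-module such that
`1 ⊗ s : M ⊗_R P → M ⊗_R Q` is bijective for every `s : P → Q` in `σ`, then the map
`M → M ⊗_R σ⁻¹R`, `m ↦ m ⊗ 1`, is bijective and `Tor_1^R(M, σ⁻¹R) = 0`. -/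
theorem bijective_tmul_one_and_tor1_eq_zero
    (s : ∀ i, P i →ₗ[R] Q i)
    (hPfin : ∀ i, Module.Finite R (P i)) (hPproj : ∀ i, Module.Projective R (P i))
    (hQfin : ∀ i, Module.Finite R (Q i)) (hQproj : ∀ i, Module.Projective R (Q i))
    (S : Type u) [Ring S] [Module Rᵐᵒᵖ S] [Module R S] (f : R →+* S)
    (hleft : ∀ (r : R) (x : S), r • x = f r * x)
    (huniv : IsUniversalInverting s S f)
    (M : Type u) [AddCommGroup M] [Module Rᵐᵒᵖ M]
    (hM : ∀ i, Function.Bijective (BTensor.mapRight (M := M) (s i))) :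
    Function.Bijective (fun m : M => BTensor.tmul (R := R) m (1 : S)) ∧
    Tor1Vanishes R M S := by
  let instN (K : Type u) [AddCommGroup K] [Module Rᵐᵒᵖ K] : Module Sᵐᵒᵖ (BTensor R K S) :=
    BTensor.rightModule hleft
  have smul_tmul (K : Type u) [AddCommGroup K] [Module Rᵐᵒᵖ K] (k : K) (a b : S) :
      op a • BTensor.tmul (R := R) k b = BTensor.tmul k (b * a) := rfl
  let instR (K : Type u) [AddCommGroup K] [Module Rᵐᵒᵖ K] : Module Rᵐᵒᵖ (BTensor R K S) :=
    Module.compHom _ (RingHom.op f)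
  have compat (K : Type u) [AddCommGroup K] [Module Rᵐᵒᵖ K] (r : R) (z : BTensor R K S) :
      op (f r) • z = op r • z := rfl
  let unit (K : Type u) [AddCommGroup K] [Module Rᵐᵒᵖ K] : K →ₗ[Rᵐᵒᵖ] BTensor R K S :=
    { toFun k := BTensor.tmul k 1
      map_add' k k' := BTensor.add_tmul k k' 1
      map_smul' r k := by
        obtain ⟨r, rfl⟩ := op_surjective r
        rw [BTensor.smul_tmul, hleft, RingHom.id_apply, ← compat, smul_tmul, one_mul, mul_one] }
  have unit_apply (K : Type u) [AddCommGroup K] [Module Rᵐᵒᵖ K] (k : K) :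
      unit K k = BTensor.tmul k 1 := rfl
  constructor
  · obtain ⟨_, hMS⟩ := huniv.exists_module hM
    let act : BTensor R M S →+ M := BTensor.lift' (fun m a => op a • m)
      (fun m m' a => smul_add _ _ _) (fun m a b => by simp [add_smul])
      (fun r m a => by rw [hleft, op_mul, mul_smul, hMS])
    refine Function.bijective_iff_has_inverse.mpr ⟨act, fun m => ?_, fun z => ?_⟩
    · simp [act]
    · refine DFunLike.congr_fun (BTensor.hom_ext (φ := (unit M).toAddMonoidHom.comp act)
        (ψ := AddMonoidHom.id _) fun m a => ?_) z
      change unit M (op a • m) = BTensor.tmul m a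
      rw [huniv.map_op_smul hMS (compat M) (unit M), unit_apply, smul_tmul, one_mul]
  · intro K F _ _ _ _ i p _ hi hp hip
    let graph : K →ₗ[Rᵐᵒᵖ] BTensor R K S × F := (unit K).prod (-i)
    let E := (BTensor R K S × F) ⧸ LinearMap.range graph
    let inN : BTensor R K S →ₗ[Rᵐᵒᵖ] E :=
      (LinearMap.range graph).mkQ ∘ₗ LinearMap.inl Rᵐᵒᵖ (BTensor R K S) F
    let inF : F →ₗ[Rᵐᵒᵖ] E :=
      (LinearMap.range graph).mkQ ∘ₗ LinearMap.inr Rᵐᵒᵖ (BTensor R K S) F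
    have inF_i (k : K) : inF (i k) = inN (unit K k) := by
      refine (Submodule.Quotient.eq _).mpr ⟨-k, ?_⟩
      ext <;> simp [graph]
    have hpi (k : K) : p (i k) = 0 := (hip _).mpr ⟨k, rfl⟩
    let π : E →ₗ[Rᵐᵒᵖ] M := (LinearMap.range graph).liftQ (p ∘ₗ LinearMap.snd Rᵐᵒᵖ _ F) <| by
      rintro _ ⟨k, rfl⟩
      simp [graph, hpi]
    have inN_injective : Function.Injective inN := by
      refine (injective_iff_map_eq_zero _).mpr fun z hz => ?_
      obtain ⟨k, hk⟩ := (Submodule.Quotient.mk_eq_zero _).mp hz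
      have hk1 : unit K k = z := congrArg Prod.fst hk
      have hk2 : -i k = 0 := congrArg Prod.snd hk
      rw [neg_eq_zero, map_eq_zero_iff i hi] at hk2
      rw [← hk1, hk2, map_zero]
    have π_surjective : Function.Surjective π := fun m => by
      obtain ⟨x, rfl⟩ := hp m
      exact ⟨inF x, rfl⟩
    have π_inN (z : BTensor R K S) : π (inN z) = 0 := map_zero p
    have exact_π (x : E) (hx : π x = 0) : ∃ z, inN z = x := by
      obtain ⟨⟨z, y⟩, rfl⟩ := Submodule.mkQ_surjective _ x
      obtain ⟨k, rfl⟩ := (hip y).mp hx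
      refine ⟨z + unit K k, ?_⟩
      rw [map_add, ← inF_i]
      change (LinearMap.range graph).mkQ _ + (LinearMap.range graph).mkQ _ = _
      rw [← map_add]
      simp
    have hE (j) : Function.Bijective (BTensor.mapRight (M := E) (s j)) :=
      BTensor.bijective_mapRight_of_exact inN_injective π_surjective π_inN exact_π (s j)
        (BTensor.bijective_mapRight_of_module huniv.1.1 (compat K) (s j) (huniv.1.2 j)) (hM j)
    obtain ⟨_, hES⟩ := huniv.exists_module hE
    let ext : BTensor R F S →+ E := BTensor.lift' (fun x a => op a • inF x)
      (fun x y a => by rw [map_add, smul_add]) (fun x a b => by rw [op_add, add_smul])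
      (fun r x a => by rw [hleft, op_mul, mul_smul, hES, map_smul])
    have h_ext (z : BTensor R K S) : ext (BTensor.mapLeft i z) = inN z := by
      refine DFunLike.congr_fun (BTensor.hom_ext (φ := ext.comp (BTensor.mapLeft i))
        (ψ := inN.toAddMonoidHom) fun k a => ?_) z
      change op a • inF (i k) = inN (BTensor.tmul k a)
      rw [inF_i, ← huniv.map_op_smul (compat K) hES inN, unit_apply, smul_tmul, one_mul]
    intro z w hzw
    exact inN_injective (by rw [← h_ext, hzw, h_ext])

end Localization
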